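/- For every n ≥ 1 and every integer a with 0 ≤ a ≤ ⌊n/2⌋, the number of fully commutative involutions of S_n having exactly a transpositions (2-cycles) in their cycle decomposition equals n!·(n−2a+1)! / (a!·(n−2a)!·(n−a+1)!), the number of standard Young tableaux of shape (n−a, a). -/

import Mathlib

/-- The simple transposition `s_i = (i, i+1)` in the symmetric group `S_n`,
for `i ∈ {1, …, n−1}` (here indexed by `Fin (n-1)`). -/
def simpleTransposition {n : ℕ} (i : Fin (n - 1)) : Equiv.Perm (Fin n) :=
  Equiv.swap ⟨i.1, by have := i.isLt; omega⟩ ⟨i.1 + 1, by have := i.isLt; omega⟩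

/-- The permutation `s_{i_1} ⋯ s_{i_k}` determined by a word `(i_1, …, i_k)`. -/
def wordProd {n : ℕ} (l : List (Fin (n - 1))) : Equiv.Perm (Fin n) :=
  (l.map simpleTransposition).prod

/-- `l` is a reduced word for `w`: it is a word for `w` of minimal length. -/
def IsReducedWord {n : ℕ} (l : List (Fin (n - 1))) (w : Equiv.Perm (Fin n)) : Prop :=
  wordProd l = w ∧ ∀ l' : List (Fin (n - 1)), wordProd l' = w → l.length ≤ l'.length

/-- One commutation move: swap two adjacent letters `a`, `b` with `|a − b| ≥ 2`. -/
def CommStep {n : ℕ} (l l' : List (Fin (n - 1))) : Prop :=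
  ∃ (u v : List (Fin (n - 1))) (a b : Fin (n - 1)),
    (a.1 + 2 ≤ b.1 ∨ b.1 + 2 ≤ a.1) ∧
    l = u ++ a :: b :: v ∧ l' = u ++ b :: a :: v

/-- Two words are commutation-equivalent if one is obtained from the other by finitely
many commutation moves. -/
def CommEquiv {n : ℕ} (l l' : List (Fin (n - 1))) : Prop :=
  Relation.ReflTransGen CommStep l l'

/-- `w ∈ S_n` is fully commutative if any two reduced words for `w` are
commutation-equivalent. -/
def FullyCommutative {n : ℕ} (w : Equiv.Perm (Fin n)) : Prop :=
  ∀ l l' : List (Fin (n - 1)), IsReducedWord l w → IsReducedWord l' w → CommEquiv l l'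

section Length

variable {n : ℕ}

/-- The smaller of the two points exchanged by `simpleTransposition i`. -/
def lowerPoint (i : Fin (n - 1)) : Fin n := ⟨i.1, by have := i.isLt; omega⟩

/-- The larger of the two points exchanged by `simpleTransposition i`. -/
def upperPoint (i : Fin (n - 1)) : Fin n := ⟨i.1 + 1, by have := i.isLt; omega⟩

theorem simpleTransposition_apply_lowerPoint (i : Fin (n - 1)) :
    simpleTransposition i (lowerPoint i) = upperPoint i := Equiv.swap_apply_left _ _

theorem simpleTransposition_apply_upperPoint (i : Fin (n - 1)) :
    simpleTransposition i (upperPoint i) = lowerPoint i := Equiv.swap_apply_right _ _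

theorem simpleTransposition_apply_of_ne {i : Fin (n - 1)} {x : Fin n} (h1 : x.1 ≠ i.1)
    (h2 : x.1 ≠ i.1 + 1) : simpleTransposition i x = x :=
  Equiv.swap_apply_of_ne_of_ne (fun h => h1 (congrArg Fin.val h)) (fun h => h2 (congrArg Fin.val h))

theorem simpleTransposition_inv (i : Fin (n - 1)) :
    (simpleTransposition i)⁻¹ = simpleTransposition i := Equiv.swap_inv _ _

theorem simpleTransposition_mul_cancel (i : Fin (n - 1)) (w : Equiv.Perm (Fin n)) :
    simpleTransposition i * (simpleTransposition i * w) = w := Equiv.swap_mul_self_mul _ _ _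

theorem simpleTransposition_val (i : Fin (n - 1)) (x : Fin n) :
    (simpleTransposition i x).1 =
      if x.1 = i.1 then i.1 + 1 else if x.1 = i.1 + 1 then i.1 else x.1 := by
  split_ifs with h1 h2
  · have : x = lowerPoint i := Fin.ext h1
    rw [this, simpleTransposition_apply_lowerPoint]; rfl
  · have : x = upperPoint i := Fin.ext h2
    rw [this, simpleTransposition_apply_upperPoint]; rfl
  · rw [simpleTransposition_apply_of_ne h1 h2]

/-- `i` is a left descent of `w`: the value `i + 1` appears to the left of `i`. -/
def IsLeftDescent (i : Fin (n - 1)) (w : Equiv.Perm (Fin n)) : Prop :=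
  w⁻¹ (upperPoint i) < w⁻¹ (lowerPoint i)

/-- The inversions of `w`, as pairs of positions. -/
def inversions (w : Equiv.Perm (Fin n)) : Finset (Fin n × Fin n) :=
  Finset.univ.filter fun x => x.1 < x.2 ∧ w x.2 < w x.1

theorem mem_inversions {w : Equiv.Perm (Fin n)} {x y : Fin n} :
    (x, y) ∈ inversions w ↔ x < y ∧ w y < w x := by simp [inversions]

theorem inversions_eq_insert {i : Fin (n - 1)} {w : Equiv.Perm (Fin n)} (h : IsLeftDescent i w) :
    inversions w = insert (w⁻¹ (upperPoint i), w⁻¹ (lowerPoint i))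
      (inversions (simpleTransposition i * w)) := by
  ext ⟨x, y⟩
  rw [Finset.mem_insert, mem_inversions, mem_inversions, Prod.mk.injEq,
    Equiv.Perm.eq_inv_iff_eq, Equiv.Perm.eq_inv_iff_eq]
  by_cases hxy : w x = upperPoint i ∧ w y = lowerPoint i
  · simp only [hxy, and_self, true_or, iff_true]
    refine ⟨?_, ?_⟩
    · rw [← Equiv.Perm.eq_inv_iff_eq, ← Equiv.Perm.eq_inv_iff_eq] at hxy
      rw [hxy.1, hxy.2]; exact h
    · simp [Fin.lt_def, upperPoint, lowerPoint]
  · by_cases hyx : w y = upperPoint i ∧ w x = lowerPoint i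
    · have : y < x := by
        rw [← Equiv.Perm.eq_inv_iff_eq, ← Equiv.Perm.eq_inv_iff_eq] at hyx
        rw [hyx.1, hyx.2]; exact h
      simp [this.not_gt, hxy]
    · simp only [hxy, false_or, and_congr_right_iff]
      intro hlt
      have hne : (w x).1 ≠ (w y).1 := fun h => hlt.ne (w.injective (Fin.ext h))
      simp only [Fin.ext_iff, upperPoint, lowerPoint] at hxy hyx
      rw [Fin.lt_def, Fin.lt_def, Equiv.Perm.mul_apply, Equiv.Perm.mul_apply,
        simpleTransposition_val, simpleTransposition_val]
      split_ifs <;> omega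

theorem inversions_subset {i : Fin (n - 1)} {w : Equiv.Perm (Fin n)} (h : IsLeftDescent i w) :
    inversions (simpleTransposition i * w) ⊆ inversions w := by
  rw [inversions_eq_insert h]; exact Finset.subset_insert _ _

theorem card_inversions_of_isLeftDescent {i : Fin (n - 1)} {w : Equiv.Perm (Fin n)}
    (h : IsLeftDescent i w) :
    (inversions w).card = (inversions (simpleTransposition i * w)).card + 1 := by
  rw [inversions_eq_insert h, Finset.card_insert_of_notMem]
  rw [mem_inversions]
  rintro ⟨-, h'⟩
  have e : ∀ x, w (w⁻¹ x) = x := fun x => by simp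
  simp only [Equiv.Perm.mul_apply, e, simpleTransposition_apply_lowerPoint,
    simpleTransposition_apply_upperPoint] at h'
  exact absurd h' (by simp [upperPoint, lowerPoint])

theorem inv_simpleTransposition_mul_apply (i : Fin (n - 1)) (w : Equiv.Perm (Fin n)) (x : Fin n) :
    (simpleTransposition i * w)⁻¹ x = w⁻¹ (simpleTransposition i x) := by
  rw [mul_inv_rev, simpleTransposition_inv, Equiv.Perm.mul_apply]

theorem isLeftDescent_simpleTransposition_mul {i : Fin (n - 1)} {w : Equiv.Perm (Fin n)}
    (h : ¬ IsLeftDescent i w) : IsLeftDescent i (simpleTransposition i * w) := by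
  rw [IsLeftDescent, inv_simpleTransposition_mul_apply, inv_simpleTransposition_mul_apply,
    simpleTransposition_apply_lowerPoint, simpleTransposition_apply_upperPoint]
  refine lt_of_le_of_ne (not_lt.1 h) fun h' => ?_
  simpa [lowerPoint, upperPoint] using (w⁻¹).injective h'

theorem card_inversions_of_not_isLeftDescent {i : Fin (n - 1)} {w : Equiv.Perm (Fin n)}
    (h : ¬ IsLeftDescent i w) :
    (inversions (simpleTransposition i * w)).card = (inversions w).card + 1 := by
  rw [card_inversions_of_isLeftDescent (isLeftDescent_simpleTransposition_mul h),
    simpleTransposition_mul_cancel]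

theorem wordProd_cons (i : Fin (n - 1)) (l : List (Fin (n - 1))) :
    wordProd (i :: l) = simpleTransposition i * wordProd l := by simp [wordProd]

theorem card_inversions_wordProd_le (l : List (Fin (n - 1))) :
    (inversions (wordProd l)).card ≤ l.length := by
  induction l with
  | nil =>
    rw [List.length_nil, Nat.le_zero, Finset.card_eq_zero]
    refine Finset.eq_empty_of_forall_notMem fun ⟨x, y⟩ h => ?_
    rw [mem_inversions] at h
    exact lt_asymm h.1 h.2
  | cons i l ih =>
    rw [wordProd_cons, List.length_cons]
    by_cases h : IsLeftDescent i (wordProd l)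
    · have := card_inversions_of_isLeftDescent h; omega
    · have := card_inversions_of_not_isLeftDescent h; omega

theorem eq_one_of_forall_not_isLeftDescent {w : Equiv.Perm (Fin n)}
    (h : ∀ i, ¬ IsLeftDescent i w) : w = 1 := by
  have hmono : StrictMono (w⁻¹ : Equiv.Perm (Fin n)) := by
    rcases n with _ | n
    · intro x; exact x.elim0
    · rw [Fin.strictMono_iff_lt_succ]
      intro i
      refine lt_of_le_of_ne (not_lt.1 (h i)) fun h' => ?_
      have := (w⁻¹).injective h'
      simp [Fin.ext_iff] at this
  have h1 : (w⁻¹ : Equiv.Perm (Fin n)) = 1 := by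
    have := Subsingleton.elim (hmono.orderIsoOfSurjective _ (w⁻¹).surjective) (OrderIso.refl _)
    ext x
    have := congrArg (fun f : Fin n ≃o Fin n => (f x).1) this
    simpa using this
  simpa using h1

theorem exists_wordProd_eq_of_length_eq_card_inversions (w : Equiv.Perm (Fin n)) :
    ∃ l, wordProd l = w ∧ l.length = (inversions w).card := by
  induction hk : (inversions w).card generalizing w with
  | zero =>
    refine ⟨[], ?_, rfl⟩
    refine (eq_one_of_forall_not_isLeftDescent fun i hi => ?_).symm
    have := card_inversions_of_isLeftDescent hi
    omega
  | succ k ih =>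
    by_cases h : ∃ i, IsLeftDescent i w
    · obtain ⟨i, hi⟩ := h
      have := card_inversions_of_isLeftDescent hi
      obtain ⟨l, hl, hlen⟩ := ih (simpleTransposition i * w) (by omega)
      exact ⟨i :: l, by rw [wordProd_cons, hl, simpleTransposition_mul_cancel], by simp [hlen]⟩
    · push Not at h
      have hw := eq_one_of_forall_not_isLeftDescent h
      have := card_inversions_wordProd_le ([] : List (Fin (n - 1)))
      rw [show wordProd ([] : List (Fin (n - 1))) = w from hw.symm, hk] at this
      simp at this

theorem isReducedWord_iff {l : List (Fin (n - 1))} {w : Equiv.Perm (Fin n)} :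
    IsReducedWord l w ↔ wordProd l = w ∧ l.length = (inversions w).card := by
  constructor
  · rintro ⟨h1, h2⟩
    obtain ⟨l', h1', h2'⟩ := exists_wordProd_eq_of_length_eq_card_inversions w
    have := h2 l' h1'
    have := card_inversions_wordProd_le l
    rw [h1] at this
    exact ⟨h1, by omega⟩
  · rintro ⟨h1, h2⟩
    refine ⟨h1, fun l' h' => ?_⟩
    have := card_inversions_wordProd_le l'
    rw [h'] at this
    omega

theorem exists_isReducedWord (w : Equiv.Perm (Fin n)) : ∃ l, IsReducedWord l w := by
  obtain ⟨l, hl⟩ := exists_wordProd_eq_of_length_eq_card_inversions w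
  exact ⟨l, isReducedWord_iff.2 hl⟩

theorem isReducedWord_cons_iff {i : Fin (n - 1)} {l : List (Fin (n - 1))}
    {w : Equiv.Perm (Fin n)} :
    IsReducedWord (i :: l) w ↔ IsLeftDescent i w ∧ IsReducedWord l (simpleTransposition i * w) := by
  rw [isReducedWord_iff, isReducedWord_iff, wordProd_cons, List.length_cons]
  constructor
  · rintro ⟨h1, h2⟩
    have h3 : wordProd l = simpleTransposition i * w := by
      rw [← h1, simpleTransposition_mul_cancel]
    have h4 := card_inversions_wordProd_le l
    rw [h3] at h4
    by_cases hd : IsLeftDescent i w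
    · have := card_inversions_of_isLeftDescent hd
      exact ⟨hd, h3, by omega⟩
    · have := card_inversions_of_not_isLeftDescent hd
      omega
  · rintro ⟨hd, h1, h2⟩
    have := card_inversions_of_isLeftDescent hd
    exact ⟨by rw [h1, simpleTransposition_mul_cancel], by omega⟩

end Length

section FullyCommutative

variable {n : ℕ}

/-- `w` has no decreasing subsequence of length three. -/
def Avoids321 (w : Equiv.Perm (Fin n)) : Prop :=
  ∀ x y z, (x, y) ∈ inversions w → (y, z) ∉ inversions w

theorem Avoids321.simpleTransposition_mul {i : Fin (n - 1)} {w : Equiv.Perm (Fin n)}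
    (hw : Avoids321 w) (h : IsLeftDescent i w) : Avoids321 (simpleTransposition i * w) :=
  fun x y z h1 h2 => hw x y z (inversions_subset h h1) (inversions_subset h h2)

theorem CommEquiv.cons {l l' : List (Fin (n - 1))} (h : CommEquiv l l') (i : Fin (n - 1)) :
    CommEquiv (i :: l) (i :: l') := by
  refine Relation.ReflTransGen.lift (List.cons i) ?_ _ _ h
  rintro _ _ ⟨u, v, a, b, hab, rfl, rfl⟩
  exact ⟨i :: u, v, a, b, hab, rfl, rfl⟩

theorem CommEquiv.perm {l l' : List (Fin (n - 1))} (h : CommEquiv l l') : l.Perm l' := by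
  induction h with
  | refl => exact List.Perm.refl _
  | tail _ h ih =>
    obtain ⟨u, v, a, b, -, rfl, rfl⟩ := h
    exact ih.trans ((List.Perm.swap b a v).append_left u)

theorem simpleTransposition_commute {i j : Fin (n - 1)} (h : i.1 + 2 ≤ j.1 ∨ j.1 + 2 ≤ i.1) :
    simpleTransposition i * simpleTransposition j =
      simpleTransposition j * simpleTransposition i := by
  ext x
  simp only [Equiv.Perm.mul_apply, simpleTransposition_val]
  split_ifs <;> omega

theorem IsLeftDescent.of_commute {i j : Fin (n - 1)} {w : Equiv.Perm (Fin n)}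
    (h : i.1 + 2 ≤ j.1 ∨ j.1 + 2 ≤ i.1) (hj : IsLeftDescent j w) :
    IsLeftDescent j (simpleTransposition i * w) := by
  rw [IsLeftDescent, inv_simpleTransposition_mul_apply, inv_simpleTransposition_mul_apply,
    simpleTransposition_apply_of_ne, simpleTransposition_apply_of_ne]
  · exact hj
  all_goals simp only [lowerPoint, upperPoint]; omega

theorem Avoids321.not_isLeftDescent_succ {i j : Fin (n - 1)} {w : Equiv.Perm (Fin n)}
    (hw : Avoids321 w) (hij : j.1 = i.1 + 1) (hi : IsLeftDescent i w) : ¬ IsLeftDescent j w := by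
  intro hj
  have e : lowerPoint j = upperPoint i := Fin.ext hij
  rw [IsLeftDescent, e] at hj
  refine hw _ _ _ (mem_inversions.2 ⟨hj, ?_⟩) (mem_inversions.2 ⟨hi, ?_⟩) <;>
    simp [Fin.lt_def, lowerPoint, upperPoint, hij]

theorem Avoids321.fullyCommutative {w : Equiv.Perm (Fin n)} (hw : Avoids321 w) :
    FullyCommutative w := by
  intro l
  induction hk : l.length using Nat.strong_induction_on generalizing l w with
  | _ k ih =>
  intro l' hl hl'
  have hlen : l.length = l'.length :=
    (isReducedWord_iff.1 hl).2.trans (isReducedWord_iff.1 hl').2.symm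
  rcases l with _ | ⟨i, l⟩
  · rw [List.length_nil, eq_comm, List.length_eq_zero_iff] at hlen
    subst hlen
    exact Relation.ReflTransGen.refl
  rcases l' with _ | ⟨j, l'⟩
  · simp at hlen
  simp only [List.length_cons, add_left_inj] at hlen hk
  rw [isReducedWord_cons_iff] at hl hl'
  obtain ⟨hi, hl⟩ := hl
  obtain ⟨hj, hl'⟩ := hl'
  rcases eq_or_ne i j with rfl | hne
  · exact (ih l.length (by omega) (hw.simpleTransposition_mul hi) l rfl l' hl hl').cons i
  have hne' : i.1 ≠ j.1 := fun h => hne (Fin.ext h)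
  by_cases hij : i.1 + 2 ≤ j.1 ∨ j.1 + 2 ≤ i.1
  · obtain ⟨m, hm⟩ := exists_isReducedWord (simpleTransposition j * (simpleTransposition i * w))
    have hm' : IsReducedWord m (simpleTransposition i * (simpleTransposition j * w)) := by
      rwa [← mul_assoc, simpleTransposition_commute hij, mul_assoc]
    have h1 := ih l.length (by omega) (hw.simpleTransposition_mul hi) l rfl (j :: m) hl
      (isReducedWord_cons_iff.2 ⟨hj.of_commute hij, hm⟩)
    have hm2 : IsReducedWord (i :: m) (simpleTransposition j * w) :=
      isReducedWord_cons_iff.2 ⟨hi.of_commute hij.symm, hm'⟩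
    have hmlen : (i :: m).length = l'.length :=
      (isReducedWord_iff.1 hm2).2.trans (isReducedWord_iff.1 hl').2.symm
    have h2 := ih (i :: m).length (by omega) (hw.simpleTransposition_mul hj) (i :: m) rfl l' hm2 hl'
    exact ((h1.cons i).tail ⟨[], m, i, j, hij, rfl, rfl⟩).trans (h2.cons j)
  · exfalso
    rcases (by omega : j.1 = i.1 + 1 ∨ i.1 = j.1 + 1) with h | h
    · exact hw.not_isLeftDescent_succ h hi hj
    · exact hw.not_isLeftDescent_succ h hj hi

theorem simpleTransposition_braid {i j : Fin (n - 1)} (h : j.1 = i.1 + 1) :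
    simpleTransposition i * (simpleTransposition j * simpleTransposition i) =
      simpleTransposition j * (simpleTransposition i * simpleTransposition j) := by
  ext x
  simp only [Equiv.Perm.mul_apply, simpleTransposition_val, h]
  have k1 : i.1 ≠ i.1 + 1 + 1 := by omega
  by_cases h0 : x.1 = i.1
  · simp [h0, k1, k1.symm]
  by_cases h1 : x.1 = i.1 + 1
  · simp [h1, k1, k1.symm]
  by_cases h2 : x.1 = i.1 + 1 + 1
  · simp [h2, k1, k1.symm]
  simp [h0, h1, h2]

theorem exists_not_perm_of_isLeftDescent_succ {i j : Fin (n - 1)} {w : Equiv.Perm (Fin n)}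
    (hij : j.1 = i.1 + 1) (hi : IsLeftDescent i w) (hj : IsLeftDescent j w) :
    ∃ l l', IsReducedWord l w ∧ IsReducedWord l' w ∧ ¬ l.Perm l' := by
  have e : lowerPoint j = upperPoint i := Fin.ext hij
  have e1 : simpleTransposition i (upperPoint j) = upperPoint j :=
    simpleTransposition_apply_of_ne (by simp [upperPoint]; omega) (by simp [upperPoint]; omega)
  have e2 : simpleTransposition j (lowerPoint i) = lowerPoint i :=
    simpleTransposition_apply_of_ne (by simp [lowerPoint]; omega) (by simp [lowerPoint]; omega)
  have e3 : simpleTransposition j (upperPoint i) = upperPoint j := by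
    rw [← e, simpleTransposition_apply_lowerPoint]
  obtain ⟨m, hm⟩ := exists_isReducedWord
    (simpleTransposition i * (simpleTransposition j * (simpleTransposition i * w)))
  have h1 : IsReducedWord (i :: j :: i :: m) w := by
    rw [isReducedWord_cons_iff, isReducedWord_cons_iff, isReducedWord_cons_iff]
    refine ⟨hi, ?_, ?_, hm⟩
    · rw [IsLeftDescent, inv_simpleTransposition_mul_apply, inv_simpleTransposition_mul_apply, e1,
        e, simpleTransposition_apply_upperPoint]
      rw [IsLeftDescent, e] at hj
      exact hj.trans hi
    · simp only [IsLeftDescent, inv_simpleTransposition_mul_apply, e2, e3, e1,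
        simpleTransposition_apply_lowerPoint]
      rwa [IsLeftDescent, e] at hj
  refine ⟨_, j :: i :: j :: m, h1, ?_, ?_⟩
  · rw [isReducedWord_iff] at h1 ⊢
    refine ⟨?_, h1.2⟩
    rw [← h1.1]
    simp only [wordProd_cons]
    simp only [← mul_assoc]
    have := simpleTransposition_braid hij
    simp only [← mul_assoc] at this
    rw [this]
  · intro h
    have hne : j ≠ i := fun h => by rw [h] at hij; omega
    have := h.count_eq i
    simp [hne] at this

theorem exists_not_perm_of_cons {i : Fin (n - 1)} {w : Equiv.Perm (Fin n)} (hi : IsLeftDescent i w)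
    (h : ∃ l l', IsReducedWord l (simpleTransposition i * w) ∧
      IsReducedWord l' (simpleTransposition i * w) ∧ ¬ l.Perm l') :
    ∃ l l', IsReducedWord l w ∧ IsReducedWord l' w ∧ ¬ l.Perm l' := by
  obtain ⟨l, l', h1, h2, h3⟩ := h
  exact ⟨i :: l, i :: l', isReducedWord_cons_iff.2 ⟨hi, h1⟩, isReducedWord_cons_iff.2 ⟨hi, h2⟩,
    fun h => h3 h.cons_inv⟩

theorem exists_not_perm_of_inv_lt (N : ℕ) : ∀ (w : Equiv.Perm (Fin n)) (x y z : Fin n),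
    (inversions w).card + x.1 - z.1 ≤ N → z < y → y < x → w⁻¹ x < w⁻¹ y → w⁻¹ y < w⁻¹ z →
    ∃ l l', IsReducedWord l w ∧ IsReducedWord l' w ∧ ¬ l.Perm l' := by
  induction N with
  | zero =>
    intro w x y z hN hzy hyx
    omega
  | succ N ih =>
    intro w x y z hN hzy hyx h1 h2
    by_cases hz : z.1 + 1 = y.1
    · by_cases hx : y.1 + 1 = x.1
      · have hxn := x.isLt
        obtain ⟨i, hi⟩ : ∃ i : Fin (n - 1), i.1 = z.1 := ⟨⟨z.1, by omega⟩, rfl⟩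
        obtain ⟨j, hj⟩ : ∃ j : Fin (n - 1), j.1 = y.1 := ⟨⟨y.1, by omega⟩, rfl⟩
        have a1 : lowerPoint i = z := Fin.ext hi
        have a2 : upperPoint i = y := Fin.ext (by simp [upperPoint]; omega)
        have a3 : lowerPoint j = y := Fin.ext hj
        have a4 : upperPoint j = x := Fin.ext (by simp [upperPoint]; omega)
        refine exists_not_perm_of_isLeftDescent_succ (i := i) (j := j) (by omega) ?_ ?_
        · rwa [IsLeftDescent, a1, a2]
        · rwa [IsLeftDescent, a3, a4]
      · have hxn := x.isLt
        obtain ⟨c, hc⟩ : ∃ c : Fin n, c.1 + 1 = x.1 := ⟨⟨x.1 - 1, by omega⟩, by simp; omega⟩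
        rcases lt_trichotomy (w⁻¹ c) (w⁻¹ y) with h | h | h
        · exact ih w c y z (by omega) hzy (by omega) h h2
        · have := (w⁻¹).injective h
          subst this
          omega
        · obtain ⟨i, hi⟩ : ∃ i : Fin (n - 1), i.1 = c.1 := ⟨⟨c.1, by omega⟩, rfl⟩
          have a1 : lowerPoint i = c := Fin.ext hi
          have a2 : upperPoint i = x := Fin.ext (by simp [upperPoint]; omega)
          have hd : IsLeftDescent i w := by rw [IsLeftDescent, a1, a2]; exact h1.trans h
          have hcard := card_inversions_of_isLeftDescent hd
          refine exists_not_perm_of_cons hd (ih _ c y z (by omega) hzy (by omega) ?_ ?_)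
          · rw [inv_simpleTransposition_mul_apply, inv_simpleTransposition_mul_apply, ← a1,
              simpleTransposition_apply_lowerPoint, a2, simpleTransposition_apply_of_ne] <;>
            first | assumption | omega
          · rw [inv_simpleTransposition_mul_apply, inv_simpleTransposition_mul_apply,
              simpleTransposition_apply_of_ne, simpleTransposition_apply_of_ne] <;>
            first | assumption | omega
    · obtain ⟨c, hc⟩ : ∃ c : Fin n, c.1 = z.1 + 1 := ⟨⟨z.1 + 1, by omega⟩, rfl⟩
      rcases lt_trichotomy (w⁻¹ c) (w⁻¹ y) with h | h | h
      · have hyn := y.isLt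
        obtain ⟨i, hi⟩ : ∃ i : Fin (n - 1), i.1 = z.1 := ⟨⟨z.1, by omega⟩, rfl⟩
        have a1 : lowerPoint i = z := Fin.ext hi
        have a2 : upperPoint i = c := Fin.ext (by simp [upperPoint]; omega)
        have hd : IsLeftDescent i w := by rw [IsLeftDescent, a1, a2]; exact h.trans h2
        have hcard := card_inversions_of_isLeftDescent hd
        refine exists_not_perm_of_cons hd (ih _ x y c (by omega) (by omega) hyx ?_ ?_)
        · rw [inv_simpleTransposition_mul_apply, inv_simpleTransposition_mul_apply,
            simpleTransposition_apply_of_ne, simpleTransposition_apply_of_ne] <;>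
          first | assumption | omega
        · rw [inv_simpleTransposition_mul_apply, inv_simpleTransposition_mul_apply, ← a2,
            simpleTransposition_apply_upperPoint, a1, simpleTransposition_apply_of_ne] <;>
          first | assumption | omega
      · have := (w⁻¹).injective h
        subst this
        omega
      · exact ih w x y c (by omega) (by omega) hyx h1 h

theorem fullyCommutative_iff_avoids321 {w : Equiv.Perm (Fin n)} :
    FullyCommutative w ↔ Avoids321 w := by
  refine ⟨fun hw x y z hxy hyz => ?_, Avoids321.fullyCommutative⟩
  rw [mem_inversions] at hxy hyz
  obtain ⟨l, l', h1, h2, h3⟩ := exists_not_perm_of_inv_lt _ w (w x) (w y) (w z) le_rfl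
    hyz.2 hxy.2 (by simpa using hxy.1) (by simpa using hyz.1)
  exact h3 (hw l l' h1 h2).perm

end FullyCommutative

open scoped Classical in
/-- The involutions supported on `L ∪ R` with `a` excedances that are nonnesting, have no fixed
point of `L ∪ R` under an arc, and send every point of `R` to a smaller point. -/
noncomputable def nonnestingInvolutions {α : Type*} [LinearOrder α] [Fintype α]
    (L R : Finset α) (a : ℕ) : Finset (Equiv.Perm α) :=
  Finset.univ.filter fun w =>
    (∀ x, w (w x) = x) ∧ (∀ x, x ∉ L → x ∉ R → w x = x) ∧
    (∀ x y, x < y → x < w x → y < w y → w x < w y) ∧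
    (∀ x, (x ∈ L ∨ x ∈ R) → w x = x → ∀ y, y < x → w y < x) ∧
    (∀ x ∈ R, w x < x) ∧ (Finset.univ.filter fun x => w x < x).card = a

section Counting

variable {α : Type*} [LinearOrder α] [Fintype α]

theorem mem_nonnestingInvolutions {L R : Finset α} {a : ℕ} {w : Equiv.Perm α} :
    w ∈ nonnestingInvolutions L R a ↔
    (∀ x, w (w x) = x) ∧ (∀ x, x ∉ L → x ∉ R → w x = x) ∧
    (∀ x y, x < y → x < w x → y < w y → w x < w y) ∧
    (∀ x, (x ∈ L ∨ x ∈ R) → w x = x → ∀ y, y < x → w y < x) ∧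
    (∀ x ∈ R, w x < x) ∧ (Finset.univ.filter fun x => w x < x).card = a := by
  simp [nonnestingInvolutions]

theorem card_filter_apply_lt_eq_card_filter_lt_apply {w : Equiv.Perm α}
    (hw : ∀ x, w (w x) = x) :
    (Finset.univ.filter fun x => w x < x).card = (Finset.univ.filter fun x => x < w x).card := by
  refine Finset.card_bij (fun x _ => w x) ?_ ?_ ?_
  · intro x hx; simpa [hw] using hx
  · intro x _ y _ h; exact w.injective h
  · intro y hy; exact ⟨w y, by simpa [hw] using hy, hw y⟩

theorem card_filter_apply_ne {w : Equiv.Perm α} (hw : ∀ x, w (w x) = x) :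
    (Finset.univ.filter fun x => w x ≠ x).card =
      2 * (Finset.univ.filter fun x => w x < x).card := by
  have h : (Finset.univ.filter fun x => w x ≠ x) =
      (Finset.univ.filter fun x => w x < x) ∪ (Finset.univ.filter fun x => x < w x) := by
    ext x; simp
  rw [h, Finset.card_union_of_disjoint, ← card_filter_apply_lt_eq_card_filter_lt_apply hw, two_mul]
  rw [Finset.disjoint_filter]
  intro x _ h1 h2
  exact lt_asymm h1 h2

theorem nonnestingInvolutions_eq_empty_of_lt_card {L R : Finset α} {a : ℕ} (h : a < R.card) :
    nonnestingInvolutions L R a = ∅ := by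
  refine Finset.eq_empty_of_forall_notMem fun w hw => ?_
  obtain ⟨-, -, -, -, h5, h6⟩ := mem_nonnestingInvolutions.1 hw
  have : R ⊆ Finset.univ.filter fun x => w x < x := fun x hx => by simpa using h5 x hx
  have := Finset.card_le_card this
  omega

theorem nonnestingInvolutions_eq_empty_of_card_lt {L : Finset α} {a : ℕ} (h : L.card < 2 * a) :
    nonnestingInvolutions L ∅ a = ∅ := by
  refine Finset.eq_empty_of_forall_notMem fun w hw => ?_
  obtain ⟨h1, h2, -, -, -, h6⟩ := mem_nonnestingInvolutions.1 hw
  have : (Finset.univ.filter fun x => w x ≠ x) ⊆ L := fun x hx => by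
    by_contra hL
    exact (Finset.mem_filter.1 hx).2 (h2 x hL (by simp))
  have := Finset.card_le_card this
  rw [card_filter_apply_ne h1] at this
  omega

theorem nonnestingInvolutions_empty_empty :
    nonnestingInvolutions (∅ : Finset α) ∅ 0 = {1} := by
  ext w
  rw [mem_nonnestingInvolutions, Finset.mem_singleton]
  constructor
  · rintro ⟨-, h2, -⟩
    ext x
    exact h2 x (by simp) (by simp)
  · rintro rfl
    simp

section Insert

variable {L R : Finset α} {p : α} {a : ℕ}

theorem filter_apply_lt_nonnestingInvolutions :
    (nonnestingInvolutions (insert p L) R a).filter (fun w => w p < p) =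
      nonnestingInvolutions L (insert p R) a := by
  ext w
  simp only [Finset.mem_filter, mem_nonnestingInvolutions, Finset.mem_insert]
  constructor
  · rintro ⟨⟨h1, h2, h3, h4, h5, h6⟩, hp⟩
    grind
  · rintro ⟨h1, h2, h3, h4, h5, h6⟩
    refine ⟨⟨h1, ?_, h3, ?_, ?_, h6⟩, ?_⟩ <;> grind

theorem mem_of_apply_ne {w : Equiv.Perm α} (hw : w ∈ nonnestingInvolutions L R a) {x : α}
    (hx : w x ≠ x) : x ∈ L ∨ x ∈ R := by
  obtain ⟨h1, h2, -⟩ := mem_nonnestingInvolutions.1 hw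
  by_contra h
  push Not at h
  exact hx (h2 x h.1 h.2)

theorem filter_not_apply_lt_nonnestingInvolutions_empty (hL : ∀ x ∈ L, x < p) :
    (nonnestingInvolutions (insert p L) ∅ a).filter (fun w => ¬ w p < p) =
      nonnestingInvolutions L ∅ a := by
  have hpL : p ∉ L := fun h => lt_irrefl _ (hL p h)
  ext w
  rw [Finset.mem_filter]
  constructor
  · rintro ⟨hw, hp⟩
    have hm : ∀ x, w x ≠ x → x ∈ insert p L ∨ x ∈ (∅ : Finset α) := fun x => mem_of_apply_ne hw
    rw [mem_nonnestingInvolutions] at hw ⊢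
    obtain ⟨h1, h2, h3, h4, h5, h6⟩ := hw
    have hpp : w p = p := by
      by_contra hne
      have := hm (w p) (by rw [h1]; exact Ne.symm hne)
      simp only [Finset.mem_insert, Finset.notMem_empty, or_false] at this
      grind
    refine ⟨h1, ?_, h3, ?_, h5, h6⟩ <;> grind
  · intro hw
    have hm : ∀ x, w x ≠ x → x ∈ L ∨ x ∈ (∅ : Finset α) := fun x => mem_of_apply_ne hw
    rw [mem_nonnestingInvolutions] at hw ⊢
    obtain ⟨h1, h2, h3, h4, h5, h6⟩ := hw
    have hpp : w p = p := h2 p hpL (by simp)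
    refine ⟨⟨h1, ?_, h3, ?_, h5, h6⟩, by simp [hpp]⟩
    · grind
    · intro x hx hwx y hy
      by_cases hxp : x = p
      · subst hxp
        by_cases hwy : w y = y
        · rw [hwy]; exact hy
        · have := hm (w y) (by rw [h1]; exact Ne.symm hwy)
          simp only [Finset.notMem_empty, or_false] at this
          exact hL _ this
      · exact h4 x (by simpa [hxp] using hx) hwx y hy

theorem apply_eq_max_of_not_apply_lt {q : α} {w : Equiv.Perm α}
    (hL : ∀ x ∈ L, x < p) (hR : ∀ x ∈ R, p < x) (hq : q ∈ R) (hmax : ∀ x ∈ R, x ≤ q)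
    (hw : w ∈ nonnestingInvolutions (insert p L) R a) (hp : ¬ w p < p) : w p = q := by
  have hm : ∀ x, w x ≠ x → x ∈ insert p L ∨ x ∈ R := fun x => mem_of_apply_ne hw
  rw [mem_nonnestingInvolutions] at hw
  obtain ⟨h1, h2, h3, h4, h5, h6⟩ := hw
  by_contra hne
  have hwq : w q < q := h5 q hq
  have hwqL : w q ∈ insert p L := by
    rcases hm (w q) (by rw [h1]; exact hwq.ne') with h | h
    · exact h
    · have := h5 _ h
      rw [h1] at this
      exact absurd this (lt_asymm hwq)
  have hwqp : w q ≠ p := fun h => hne (by rw [← h, h1])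
  have hlt : w q < p := hL _ ((Finset.mem_insert.1 hwqL).resolve_left hwqp)
  have hpq := hR q hq
  rcases lt_or_eq_of_le (not_lt.1 hp) with hlt' | heq
  · have h := h3 (w q) p hlt (by rw [h1]; exact hwq) hlt'
    rw [h1] at h
    rcases hm (w p) (by rw [h1]; exact hlt'.ne) with h' | h'
    · grind
    · exact absurd h (not_lt.2 (hmax _ h'))
  · have h := h4 p (by simp) heq.symm (w q) hlt
    rw [h1] at h
    exact lt_asymm h hpq

theorem card_filter_not_apply_lt_nonnestingInvolutions {q : α}
    (hL : ∀ x ∈ L, x < p) (hR : ∀ x ∈ R, p < x) (hq : q ∈ R) (hmax : ∀ x ∈ R, x ≤ q) :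
    ((nonnestingInvolutions (insert p L) R (a + 1)).filter (fun w => ¬ w p < p)).card =
      (nonnestingInvolutions L (R.erase q) a).card := by
  have hpq : p < q := hR q hq
  have hpL : p ∉ L := fun h => lt_irrefl _ (hL p h)
  have hqL : q ∉ L := fun h => lt_asymm hpq (hL q h)
  have hpR : p ∉ R := fun h => lt_irrefl _ (hR p h)
  refine Finset.card_nbij' (fun w => Equiv.swap p q * w) (fun w => Equiv.swap p q * w)
    ?_ ?_ (fun w _ => by simp) (fun w _ => by simp)
  · intro w hw
    rw [Finset.mem_coe, Finset.mem_filter] at hw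
    obtain ⟨hw, hp⟩ := hw
    have hwp : w p = q := apply_eq_max_of_not_apply_lt hL hR hq hmax hw hp
    rw [mem_nonnestingInvolutions] at hw
    obtain ⟨h1, h2, h3, h4, h5, h6⟩ := hw
    have hwq : w q = p := by rw [← hwp, h1]
    have ep : (Equiv.swap p q * w) p = p := by simp [hwp]
    have eq : (Equiv.swap p q * w) q = q := by simp [hwq]
    have eo : ∀ x, x ≠ p → x ≠ q → (Equiv.swap p q * w) x = w x := fun x hx hx' => by
      rw [Equiv.Perm.mul_apply, Equiv.swap_apply_of_ne_of_ne]
      · rw [← hwq]; exact fun h => hx' (w.injective h)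
      · rw [← hwp]; exact fun h => hx (w.injective h)
    have np : ∀ x, x ≠ p → x ≠ q → w x ≠ p ∧ w x ≠ q := fun x hx hx' =>
      ⟨by rw [← hwq]; exact fun h => hx' (w.injective h),
        by rw [← hwp]; exact fun h => hx (w.injective h)⟩
    have hfil : (Finset.univ.filter fun x => w x < x) =
        insert q (Finset.univ.filter fun x => (Equiv.swap p q * w) x < x) := by
      ext x
      simp only [Finset.mem_filter, Finset.mem_univ, true_and, Finset.mem_insert]
      by_cases hxp : x = p
      · subst hxp; simp [hwp, hpq.ne, hpq.not_gt]
      · by_cases hxq : x = q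
        · subst hxq; simp [hwq, hpq]
        · simp [eo x hxp hxq, hxq, -Equiv.Perm.coe_mul]
    rw [hfil, Finset.card_insert_of_notMem (by rw [Finset.mem_filter, eq]; simp)] at h6
    change Equiv.swap p q * w ∈ nonnestingInvolutions L (R.erase q) a
    rw [mem_nonnestingInvolutions]
    generalize Equiv.swap p q * w = w' at *
    simp only [Finset.mem_insert, Finset.mem_erase] at *
    clear hfil
    have hfix : ∀ x, w' x ≠ x → x ≠ p ∧ x ≠ q := by grind
    refine ⟨fun x => ?_, fun x hxL hxR => ?_, fun x y hxy hx hy => ?_, fun x hx hwx y hy => ?_,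
      fun x hx => ?_, by omega⟩
    · by_cases hxp : x = p
      · rw [hxp, ep, ep]
      · by_cases hxq : x = q
        · rw [hxq, eq, eq]
        · rw [eo x hxp hxq, eo _ (np x hxp hxq).1 (np x hxp hxq).2, h1]
    · grind
    · obtain ⟨hxp, hxq⟩ := hfix x hx.ne'
      obtain ⟨hyp, hyq⟩ := hfix y hy.ne'
      rw [eo x hxp hxq] at hx ⊢
      rw [eo y hyp hyq] at hy ⊢
      exact h3 x y hxy hx hy
    · by_cases hyp : y = p
      · rwa [hyp, ep, ← hyp]
      · by_cases hyq : y = q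
        · rwa [hyq, eq, ← hyq]
        · rw [eo y hyp hyq]
          have hxp : x ≠ p := by grind
          have hxq : x ≠ q := by grind
          rw [eo x hxp hxq] at hwx
          exact h4 x (by tauto) hwx y hy
    · rw [eo x (fun h => hpR (h ▸ hx.2)) hx.1]
      exact h5 x hx.2
  · intro w hw
    rw [Finset.mem_coe] at hw
    have hm : ∀ x, w x ≠ x → x ∈ L ∨ x ∈ R.erase q := fun x => mem_of_apply_ne hw
    rw [mem_nonnestingInvolutions] at hw
    obtain ⟨h1, h2, h3, h4, h5, h6⟩ := hw
    have hwp : w p = p := h2 p hpL (by simp [hpR])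
    have hwq : w q = q := h2 q hqL (by simp)
    have ep : (Equiv.swap p q * w) p = q := by simp [hwp]
    have eq : (Equiv.swap p q * w) q = p := by simp [hwq]
    have np : ∀ x, x ≠ p → x ≠ q → w x ≠ p ∧ w x ≠ q := fun x hx hx' =>
      ⟨fun h => hx (w.injective (h.trans hwp.symm)), fun h => hx' (w.injective (h.trans hwq.symm))⟩
    have eo : ∀ x, x ≠ p → x ≠ q → (Equiv.swap p q * w) x = w x := fun x hx hx' => by
      rw [Equiv.Perm.mul_apply, Equiv.swap_apply_of_ne_of_ne (np x hx hx').1 (np x hx hx').2]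
    have hfil : (Finset.univ.filter fun x => (Equiv.swap p q * w) x < x) =
        insert q (Finset.univ.filter fun x => w x < x) := by
      ext x
      simp only [Finset.mem_filter, Finset.mem_univ, true_and, Finset.mem_insert]
      by_cases hxp : x = p
      · subst hxp; simp [hwp, hpq.ne, hpq.not_gt]
      · by_cases hxq : x = q
        · subst hxq; simp [hwq, hpq]
        · simp [eo x hxp hxq, hxq, -Equiv.Perm.coe_mul]
    change Equiv.swap p q * w ∈ Finset.filter _ _
    rw [Finset.mem_filter, mem_nonnestingInvolutions, hfil,
      Finset.card_insert_of_notMem (by simp [hwq]), h6]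
    generalize Equiv.swap p q * w = w' at *
    simp only [Finset.mem_insert, Finset.mem_erase] at *
    have hop : ∀ x, x < w x → x ∈ L ∧ w x < q := by
      intro x hx
      have hxm := hm x hx.ne'
      have hwm := hm (w x) (by rw [h1]; exact hx.ne)
      grind
    clear hfil
    refine ⟨⟨fun x => ?_, ?_, ?_, ?_, ?_, trivial⟩, ?_⟩
    · by_cases hxp : x = p
      · rw [hxp, ep, eq]
      · by_cases hxq : x = q
        · rw [hxq, eq, ep]
        · rw [eo x hxp hxq, eo _ (np x hxp hxq).1 (np x hxp hxq).2, h1]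
    · grind
    · intro x y hxy hx hy
      have hxq : x ≠ q := by
        intro h
        rw [h, eq] at hx
        exact lt_asymm hpq hx
      have hyq : y ≠ q := by
        intro h
        rw [h, eq] at hy
        exact lt_asymm hpq hy
      by_cases hyp : y = p
      · have hxp : x ≠ p := fun h => hxy.ne (h.trans hyp.symm)
        rw [eo x hxp hxq] at hx ⊢
        rw [hyp, ep]
        exact (hop x hx).2
      · rw [eo y hyp hyq] at hy ⊢
        have hxp : x ≠ p := (hxy.trans (hL y (hop y hy).1)).ne
        rw [eo x hxp hxq] at hx ⊢
        exact h3 x y hxy hx hy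
    · intro x hx hwx y hy
      have hxp : x ≠ p := by grind
      have hxq : x ≠ q := by grind
      have hxL : x ∈ L := by grind
      have hyp : y < p := hy.trans (hL x hxL)
      rw [eo x hxp hxq] at hwx
      rw [eo y hyp.ne (hyp.trans hpq).ne]
      exact h4 x (Or.inl hxL) hwx y hy
    · intro x hx
      by_cases hxq : x = q
      · rw [hxq, eq]
        exact hpq
      · rw [eo x (hR x hx).ne' hxq]
        exact h5 x ⟨hxq, hx⟩
    · grind

end Insert

theorem card_nonnestingInvolutions (L : Finset α) : ∀ (R : Finset α) (b : ℕ),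
    (∀ x ∈ L, ∀ y ∈ R, x < y) → 2 * b + R.card ≤ L.card →
    (nonnestingInvolutions L R (b + R.card)).card + (L.card + 1).choose b =
      2 * L.card.choose b := by
  induction L using Finset.induction_on_max with
  | empty =>
    intro R b _ h
    rw [Finset.card_empty] at h
    have hb : b = 0 := by omega
    have hR : R = ∅ := Finset.card_eq_zero.1 (by omega)
    subst hb hR
    simp [nonnestingInvolutions_empty_empty]
  | insert p L hL ih =>
    intro R b hLR h
    have hpL : p ∉ L := fun h => lt_irrefl _ (hL p h)
    have hpR : p ∉ R := fun h => lt_irrefl _ (hLR p (by simp) p h)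
    have hRp : ∀ x ∈ R, p < x := hLR p (by simp)
    rw [Finset.card_insert_of_notMem hpL] at h ⊢
    rw [← Finset.card_filter_add_card_filter_not (s := nonnestingInvolutions (insert p L) R _)
      (fun w => w p < p), filter_apply_lt_nonnestingInvolutions]
    have hcard : (insert p R).card = R.card + 1 := Finset.card_insert_of_notMem hpR
    have hclose : b = 0 ∧ (nonnestingInvolutions L (insert p R) (b + R.card)).card = 0 ∨
        ∃ c, b = c + 1 ∧ (nonnestingInvolutions L (insert p R) (b + R.card)).card +
          (L.card + 1).choose c = 2 * L.card.choose c := by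
      rcases b with _ | c
      · left
        exact ⟨rfl, by rw [nonnestingInvolutions_eq_empty_of_lt_card (by omega)]; rfl⟩
      · right
        refine ⟨c, rfl, ?_⟩
        have := ih (insert p R) c (by
          intro x hx y hy
          rcases Finset.mem_insert.1 hy with rfl | hy
          · exact hL x hx
          · exact hLR x (by simp [hx]) y hy) (by omega)
        rwa [hcard, show c + (R.card + 1) = c + 1 + R.card by ring] at this
    have hother : ((nonnestingInvolutions (insert p L) R (b + R.card)).filter
        (fun w => ¬ w p < p)).card + (L.card + 1).choose b = 2 * L.card.choose b := by
      rcases R.eq_empty_or_nonempty with rfl | hne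
      · rw [filter_not_apply_lt_nonnestingInvolutions_empty hL]
        by_cases hb : 2 * b ≤ L.card
        · exact ih ∅ b (by simp) (by simpa using hb)
        · simp only [Finset.card_empty, add_zero] at h ⊢
          rw [nonnestingInvolutions_eq_empty_of_card_lt (by omega)]
          obtain ⟨c, rfl⟩ : ∃ c, b = c + 1 := ⟨b - 1, by omega⟩
          have hc : L.card = 2 * c + 1 := by omega
          rw [hc, Nat.choose_succ_succ, Nat.choose_symm_half]
          simp [two_mul]
      · have hq := R.max'_mem hne
        have hpos := hne.card_pos
        obtain ⟨k, hk⟩ : ∃ k, R.card = k + 1 := ⟨R.card - 1, by omega⟩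
        have hk' : (R.erase (R.max' hne)).card = k := by rw [Finset.card_erase_of_mem hq]; omega
        rw [hk, ← add_assoc, card_filter_not_apply_lt_nonnestingInvolutions hL hRp hq
          (fun x hx => R.le_max' x hx)]
        have := ih (R.erase (R.max' hne)) b
          (fun x hx y hy => hLR x (by simp [hx]) y (Finset.mem_of_mem_erase hy)) (by omega)
        rwa [hk'] at this
    rcases hclose with ⟨rfl, h0⟩ | ⟨c, rfl, hc⟩
    · simp only [Nat.choose_zero_right] at *
      omega
    · have hchoose := Nat.choose_succ_succ' (L.card + 1) c
      have hchoose' := Nat.choose_succ_succ' L.card c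
      omega

end Counting

theorem avoids321_iff_of_involution {n : ℕ} {w : Equiv.Perm (Fin n)} (hw : ∀ x, w (w x) = x) :
    Avoids321 w ↔ (∀ x y, x < y → x < w x → y < w y → w x < w y) ∧
      ∀ x, w x = x → ∀ y, y < x → w y < x := by
  constructor
  · intro h
    refine ⟨fun x y hxy hx hy => ?_, fun x hx y hy => ?_⟩
    · by_contra hlt
      have hne : w y ≠ w x := fun h => hxy.ne' (w.injective h)
      have hlt' : w y < w x := lt_of_le_of_ne (not_lt.1 hlt) hne
      exact h x y (w y) (mem_inversions.2 ⟨hxy, hlt'⟩)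
        (mem_inversions.2 ⟨hy, by rwa [hw]⟩)
    · by_contra hlt
      have hne : x ≠ w y := fun h => hy.ne' (w.injective (hx.trans h))
      have hlt' : x < w y := lt_of_le_of_ne (not_lt.1 hlt) hne
      exact h y x (w y) (mem_inversions.2 ⟨hy, by rwa [hx]⟩)
        (mem_inversions.2 ⟨hlt', by rwa [hw, hx]⟩)
  · rintro ⟨h1, h2⟩ x y z hxy hyz
    rw [mem_inversions] at hxy hyz
    rcases lt_trichotomy y (w y) with h | h | h
    · exact lt_asymm hxy.2 (h1 x y hxy.1 (hxy.1.trans (h.trans hxy.2)) h)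
    · exact lt_asymm hxy.2 (by rw [← h]; exact h2 y h.symm x hxy.1)
    · have := h1 (w z) (w y) hyz.2 (by rw [hw]; exact hyz.2.trans (h.trans hyz.1))
        (by rwa [hw])
      rw [hw, hw] at this
      exact lt_asymm this hyz.1

theorem eq_factorial_div_of_add_choose_eq {n a c : ℕ} (ha : 2 * a ≤ n)
    (h : c + (n + 1).choose a = 2 * n.choose a) :
    c = Nat.factorial n * Nat.factorial (n - 2 * a + 1) /
        (Nat.factorial a * Nat.factorial (n - 2 * a) * Nat.factorial (n - a + 1)) := by
  obtain ⟨d, rfl⟩ := Nat.exists_eq_add_of_le ha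
  have e1 : 2 * a + d - 2 * a = d := by omega
  have e2 : 2 * a + d - a = a + d := by omega
  have k1 := Nat.choose_mul_factorial_mul_factorial (show a ≤ 2 * a + d by omega)
  have k2 := Nat.choose_mul_factorial_mul_factorial (show a ≤ 2 * a + d + 1 by omega)
  rw [e2] at k1
  rw [show 2 * a + d + 1 - a = a + d + 1 by omega] at k2
  rw [e1, e2]
  symm
  apply Nat.div_eq_of_eq_mul_left
  · positivity
  rw [Nat.factorial_succ (2 * a + d)] at k2
  rw [Nat.factorial_succ d]
  rw [Nat.factorial_succ (a + d)] at k2 ⊢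
  zify at h k1 k2 ⊢
  linear_combination (-(a.factorial * (a + d + 1) * (a + d).factorial * d.factorial : ℤ)) * h
    - 2 * (a + d + 1) * d.factorial * k1 + d.factorial * k2

/-- The number of fully commutative involutions of `S_n` having exactly `a`
transpositions (`2`-cycles) in their cycle decomposition (i.e. moving exactly `2a`
points) equals `n!·(n−2a+1)! / (a!·(n−2a)!·(n−a+1)!)`, the number of standard Young
tableaux of shape `(n−a, a)`. -/
theorem card_fullyCommutative_involutions_with_a_transpositions
    (n : ℕ) (hn : 1 ≤ n) (a : ℕ) (ha : a ≤ n / 2) :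
    Nat.card {w : Equiv.Perm (Fin n) //
        w * w = 1 ∧ FullyCommutative w ∧
        (Finset.univ.filter fun x => w x ≠ x).card = 2 * a} =
      Nat.factorial n * Nat.factorial (n - 2 * a + 1) /
        (Nat.factorial a * Nat.factorial (n - 2 * a) * Nat.factorial (n - a + 1)) := by
  have ha' : 2 * a ≤ n := by omega
  rw [Nat.subtype_card (nonnestingInvolutions (Finset.univ : Finset (Fin n)) ∅ a)]
  · apply eq_factorial_div_of_add_choose_eq ha'
    simpa using card_nonnestingInvolutions (Finset.univ : Finset (Fin n)) ∅ a (by simp)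
      (by simpa using ha')
  · intro w
    have hinv : w * w = 1 ↔ ∀ x, w (w x) = x := by
      rw [Equiv.ext_iff]; rfl
    rw [mem_nonnestingInvolutions, hinv, fullyCommutative_iff_avoids321]
    refine and_congr_right fun hw => ?_
    rw [avoids321_iff_of_involution hw, card_filter_apply_ne hw]
    simp [and_assoc]
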